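/- For every r ≥ 3, the group Q_{2^r} × C₂ of order 2^{r+1} satisfies α(Q_{2^r} × C₂) = 2^{r+1} + 2. -/

import Mathlib

/-- `graphAlpha G` is the minimum number of vertices of a finite simple graph whose
automorphism group is isomorphic to `G`. -/
noncomputable def graphAlpha (G : Type*) [Group G] : ℕ :=
  sInf {n : ℕ | ∃ Γ : SimpleGraph (Fin n), Nonempty ((Γ ≃g Γ) ≃* G)}

/-- The cyclic group of order `n`. -/
abbrev Cyc (n : ℕ) := Multiplicative (ZMod n)


section LowerBound

open MulAction

/-- If every automorphism of `Γ` comes from the action of `G`, and the elements outside a proper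
subgroup `A` are inverted by multiplication with a central element `z`, then multiplying by `z` on
half of an orbit moved by `z` is an automorphism which does not come from `G`, provided
the rest of the graph does not tell `z`-translates in that orbit apart. -/
theorem SimpleGraph.false_of_forall_inv_eq_central_mul {G V : Type*} [Group G] [MulAction G V]
    (Γ : SimpleGraph V) (hadj : ∀ (g : G) (v w : V), Γ.Adj (g • v) (g • w) ↔ Γ.Adj v w)
    (hfull : ∀ σ : Γ ≃g Γ, ∃ g : G, ∀ v, σ v = g • v)
    (A : Subgroup G) (z : G) (hz : ∀ g, z * g = g * z)
    (hinv : ∀ x ∉ A, x⁻¹ = z * x) {b : G} (hb : b ∉ A) (o : V)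
    (hstab : ∀ g : G, g • o = o → g ∈ A ∧ ∀ x, g * x = x * g) (hzo : z • o ≠ o)
    (hout : ∀ v ∉ orbit G o, ∃ k : G, k • v = v ∧ ∀ x : G, k • x • o = z • x • o) : False := by
  classical
  have hzz : z * z = 1 := by
    have h1 := hinv b hb
    have h2 := hinv b⁻¹ (by simpa using hb)
    rw [inv_inv, h1, ← mul_assoc] at h2
    exact (mul_eq_right.mp h2.symm)
  have hzz' (v : V) : z • z • v = v := by rw [smul_smul, hzz, one_smul]
  have hzA : z ∈ A := by
    by_contra h
    have h1 := hinv z h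
    rw [hzz, inv_eq_one] at h1
    exact hzo (by rw [h1, one_smul])
  let B : Set V := {v | ∃ x ∉ A, v = x • o}
  have hzB (v : V) (hv : v ∈ B) : z • v ∈ B := by
    obtain ⟨x, hx, rfl⟩ := hv
    exact ⟨z * x, fun h => hx ((A.mul_mem_cancel_left hzA).mp h), smul_smul _ _ _⟩
  have hAB (g : G) (hg : g ∈ A) : g • o ∉ B := by
    rintro ⟨x, hx, h⟩
    have h1 : (x⁻¹ * g) • o = o := by rw [mul_smul, h, inv_smul_smul]
    exact hx (by simpa using (A.mul_mem_cancel_right hg).mp (hstab _ h1).1)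
  let f : V → V := fun v => if v ∈ B then z • v else v
  have hf1 (v : V) (hv : v ∈ B) : f v = z • v := if_pos hv
  have hf2 (v : V) (hv : v ∉ B) : f v = v := if_neg hv
  have hff : Function.Involutive f := by
    intro v
    by_cases hv : v ∈ B
    · rw [hf1 v hv, hf1 _ (hzB v hv), hzz']
    · rw [hf2 v hv, hf2 v hv]
  have hmix (v w : V) (hv : v ∈ B) (hw : w ∉ B) : Γ.Adj (z • v) w ↔ Γ.Adj v w := by
    obtain ⟨h, hh, rfl⟩ := hv
    by_cases hwo : w ∈ orbit G o
    · obtain ⟨g, rfl⟩ := hwo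
      have hg : g ∈ A := by
        by_contra hg
        exact hw ⟨g, hg, rfl⟩
      have hx : g⁻¹ * h ∉ A := by
        rw [A.mul_mem_cancel_left (A.inv_mem hg)]; exact hh
      show Γ.Adj _ (g • o) ↔ Γ.Adj _ (g • o)
      rw [← hadj g⁻¹ (h • o), ← hadj g⁻¹ (z • h • o), inv_smul_smul, smul_smul, smul_smul,
        smul_smul, ← hz g⁻¹, mul_assoc, ← hinv _ hx,
        ← hadj (g⁻¹ * h) ((g⁻¹ * h)⁻¹ • o), smul_inv_smul, Γ.adj_comm]
    · obtain ⟨k, hk, hk'⟩ := hout w hwo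
      rw [← hk' h, ← hadj k (h • o) w, hk]
  let σ : Γ ≃g Γ :=
    { toEquiv := hff.toPerm f
      map_rel_iff' := by
        intro v w
        show Γ.Adj (f v) (f w) ↔ Γ.Adj v w
        by_cases hv : v ∈ B <;> by_cases hw : w ∈ B
        · rw [hf1 v hv, hf1 w hw, hadj]
        · rw [hf1 v hv, hf2 w hw, hmix v w hv hw]
        · rw [hf2 v hv, hf1 w hw, Γ.adj_comm, hmix w v hw hv, Γ.adj_comm]
        · rw [hf2 v hv, hf2 w hw] }
  obtain ⟨g, hg⟩ := hfull σ
  have hg' (v : V) : f v = g • v := hg v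
  have ho : g • o = o := by
    rw [← hg']; exact hf2 _ (by simpa using hAB 1 A.one_mem)
  have hbo := hg' (b • o)
  rw [hf1 _ ⟨b, hb, rfl⟩, smul_smul, smul_smul, (hstab g ho).2 b, mul_smul b g, ho, hz, mul_smul] at hbo
  exact hzo (smul_left_cancel b hbo)

/-- Lower bound on the number of vertices of a graph with a given full automorphism group `G`,
when every subgroup of `G` avoiding the central element `z` is contained in `{1, t, z * t}`. -/
theorem SimpleGraph.card_add_two_le_of_forall_inv_eq_central_mul {G V : Type*} [Group G]
    [Finite G] [Finite V] [MulAction G V]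
    (Γ : SimpleGraph V) (hadj : ∀ (g : G) (v w : V), Γ.Adj (g • v) (g • w) ↔ Γ.Adj v w)
    (hfull : ∀ σ : Γ ≃g Γ, ∃ g : G, ∀ v, σ v = g • v)
    (hfaith : ∀ g : G, (∀ v : V, g • v = v) → g = 1)
    (A : Subgroup G) (z t : G) (hz : ∀ g, z * g = g * z) (ht : ∀ g, t * g = g * t)
    (hz1 : z ≠ 1) (ht1 : t ≠ 1) (hzt : z ≠ t) (hzz : z * z = 1) (htt : t * t = 1)
    (hzA : z ∈ A) (htA : t ∈ A)
    (hinv : ∀ x ∉ A, x⁻¹ = z * x) {b : G} (hb : b ∉ A)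
    (hsub : ∀ H : Subgroup G, z ∉ H → ∀ h ∈ H, h = 1 ∨ h = t ∨ h = z * t) :
    Nat.card G + 2 ≤ Nat.card V := by
  classical
  have := Fintype.ofFinite V
  have := Fintype.ofFinite G
  by_contra! hlt
  have hs (v : V) (hv : z • v ≠ v) (g : G) (hg : g • v = v) : g = 1 ∨ g = t ∨ g = z * t :=
    hsub (stabilizer G v) (fun h => hv h) g hg
  have hstab (v : V) (hv : z • v ≠ v) (g : G) (hg : g • v = v) :
      g ∈ A ∧ ∀ x, g * x = x * g := by
    rcases hs v hv g hg with rfl | rfl | rfl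
    · exact ⟨A.one_mem, by simp⟩
    · exact ⟨htA, ht⟩
    · exact ⟨A.mul_mem hzA htA, fun x => by rw [mul_assoc, ht, ← mul_assoc, hz, mul_assoc]⟩
  have horb (v : V) : Nat.card (orbit G v) * Nat.card (stabilizer G v) = Nat.card G := by
    rw [← Nat.card_prod]
    exact Nat.card_congr (orbitProdStabilizerEquivGroup G v)
  -- two points outside a set with `|G|` elements coincide
  have hcompl (S : Set V) (hS : Nat.card G ≤ S.ncard) (v w : V) (hv : v ∉ S) (hw : w ∉ S) :
      v = w := by
    by_contra hne
    have h1 : (S ∪ {v, w}).ncard = S.ncard + 2 := by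
      rw [Set.ncard_union_eq, Set.ncard_pair hne]
      rw [Set.disjoint_right]
      rintro x (rfl | rfl) <;> assumption
    have h2 := Set.ncard_le_card (S ∪ {v, w})
    omega
  obtain ⟨o₀, ho₀⟩ : ∃ o : V, z • o ≠ o := by
    by_contra! h
    exact hz1 (hfaith z h)
  by_cases hfree : ∃ o : V, z • o ≠ o ∧ t • o ≠ o ∧ (z * t) • o ≠ o
  · obtain ⟨o, hzo, hto, hzto⟩ := hfree
    have hbot : stabilizer G o = ⊥ := by
      rw [Subgroup.eq_bot_iff_forall]
      intro g hg
      rcases hs o hzo g hg with rfl | rfl | rfl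
      · rfl
      · exact absurd hg hto
      · exact absurd hg hzto
    have h1 := horb o
    rw [hbot, Subgroup.card_bot, mul_one, Nat.card_coe_set_eq] at h1
    refine Γ.false_of_forall_inv_eq_central_mul hadj hfull A z hz hinv hb o (hstab o hzo) hzo ?_
    refine fun v hv => ⟨z, ?_, fun _ => rfl⟩
    refine hcompl (orbit G o) h1.ge _ _ ?_ hv
    exact fun h => hv (by simpa using mem_orbit_of_mem_orbit z⁻¹ h)
  · push Not at hfree
    have hhalf (v : V) (hv : z • v ≠ v) : Nat.card G ≤ 2 * (orbit G v).ncard := by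
      have h1 := horb v
      rw [Nat.card_coe_set_eq] at h1
      have h2 : Nat.card (stabilizer G v) ≤ 2 := by
        obtain ⟨s, hsub⟩ : ∃ s, (stabilizer G v : Set G) ⊆ {1, s} := by
          by_cases htv : t • v = v
          · refine ⟨t, fun g hg => ?_⟩
            rcases hs v hv g hg with rfl | rfl | rfl
            · simp
            · simp
            · have h : (z * t) • v = v := hg
              rw [mul_smul, htv] at h
              exact absurd h hv
          · refine ⟨z * t, fun g hg => ?_⟩
            rcases hs v hv g hg with rfl | rfl | rfl
            · simp
            · exact absurd hg htv
            · simp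
        calc Nat.card (stabilizer G v) = (stabilizer G v : Set G).ncard := Nat.card_coe_set_eq _
          _ ≤ ({1, s} : Set G).ncard := Set.ncard_le_ncard hsub
          _ ≤ 2 := (Set.ncard_insert_le _ _).trans (by simp)
      nlinarith
    have key (s : G) (hs1 : s ≠ 1) (hsc : ∀ g, s * g = g * s)
        (hsz : ∀ v : V, z • v ≠ v → s • v = v ∨ (z * s) • v = v) (hso : s • o₀ = o₀) : False := by
      refine Γ.false_of_forall_inv_eq_central_mul hadj hfull A z hz hinv hb o₀ (hstab o₀ ho₀) ho₀ ?_
      intro v hv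
      by_cases hzv : z • v = v
      · exact ⟨z, hzv, fun _ => rfl⟩
      rcases hsz v hzv with hsv | hsv
      · exfalso
        have hdisj : Disjoint (orbit G o₀) (orbit G v) := by
          rw [Set.disjoint_left]
          intro w hw hw'
          exact hv (by rw [← orbit_eq_iff.mpr hw, orbit_eq_iff.mpr hw']; exact mem_orbit_self v)
        have hfix (v : V) (hsv : s • v = v) : ∀ w ∈ orbit G v, s • w = w := by
          rintro _ ⟨x, rfl⟩
          show s • x • v = x • v
          rw [smul_smul, hsc, mul_smul, hsv]
        refine hs1 (hfaith s fun w => ?_)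
        by_cases hw : w ∈ orbit G o₀ ∪ orbit G v
        · rcases hw with hw | hw
          · exact hfix o₀ hso w hw
          · exact hfix v hsv w hw
        · refine hcompl _ ?_ _ _ ?_ hw
          · rw [Set.ncard_union_eq hdisj]
            have := hhalf o₀ ho₀
            have := hhalf v hzv
            omega
          · refine fun h => hw (h.imp (fun h => ?_) fun h => ?_) <;>
              simpa using mem_orbit_of_mem_orbit s⁻¹ h
      · refine ⟨z * s, hsv, fun x => ?_⟩
        rw [mul_smul, smul_smul s, hsc, mul_smul x, hso]
    by_cases hto : t • o₀ = o₀
    · refine key t ht1 ht (fun v hv => ?_) hto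
      by_cases h : t • v = v
      · exact .inl h
      · exact .inr (hfree v hv h)
    · refine key (z * t) ?_ ?_ ?_ (hfree o₀ ho₀ hto)
      · intro h
        apply hzt
        calc z = z * (t * t) := by rw [htt, mul_one]
          _ = t := by rw [← mul_assoc, h, one_mul]
      · intro x
        rw [mul_assoc, ht, ← mul_assoc, hz, mul_assoc]
      · intro v hv
        rw [← mul_assoc, hzz, one_mul]
        by_cases h : t • v = v
        · exact .inr h
        · exact .inl (hfree v hv h)

end LowerBound

section UpperBound

variable {Q : Type*} [Group Q]

/-- Adjacency in a graph made of two copies of `Q`, joined by the Haar graph of `{1, a, b}` and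
carrying the Cayley graphs of `{a, a⁻¹}` and `{b, b⁻¹}` respectively, together with two vertices
adjacent to every vertex of the first copy. -/
def doubleCayleyAdj (a b : Q) : Q ⊕ Q ⊕ Cyc 2 → Q ⊕ Q ⊕ Cyc 2 → Prop
  | .inl x, .inl y => y = x * a ∨ x = y * a
  | .inl x, .inr (.inl y) => y = x ∨ y = x * a ∨ y = x * b
  | .inr (.inl y), .inl x => y = x ∨ y = x * a ∨ y = x * b
  | .inr (.inl x), .inr (.inl y) => y = x * b ∨ x = y * b
  | .inl _, .inr (.inr _) => True
  | .inr (.inr _), .inl _ => True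
  | .inr (.inl _), .inr (.inr _) => False
  | .inr (.inr _), .inr _ => False

/-- The graph with adjacency relation `doubleCayleyAdj`. -/
def doubleCayleyGraph (a b : Q) (ha : a ≠ 1) (hb : b ≠ 1) : SimpleGraph (Q ⊕ Q ⊕ Cyc 2) where
  Adj := doubleCayleyAdj a b
  symm := ⟨by
    rintro (x | x | x) (y | y | y) <;> simp [doubleCayleyAdj, or_comm]⟩
  loopless := ⟨by
    rintro (x | x | x) <;> simp [doubleCayleyAdj, ha, hb]⟩

/-- The action of `Q × Cyc 2` on `doubleCayleyGraph` by left translations. -/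
def doubleCayleyGraph.translation (a b : Q) (ha : a ≠ 1) (hb : b ≠ 1) :
    Q × Cyc 2 →* (doubleCayleyGraph a b ha hb ≃g doubleCayleyGraph a b ha hb) where
  toFun g :=
    { toEquiv := (Equiv.mulLeft g.1).sumCongr ((Equiv.mulLeft g.1).sumCongr (Equiv.mulLeft g.2))
      map_rel_iff' := by
        rintro (x | x | x) (y | y | y) <;>
          simp [doubleCayleyGraph, doubleCayleyAdj, mul_assoc] }
  map_one' := by
    ext (x | x | x) <;> simp
  map_mul' g h := by
    ext (x | x | x) <;> simp [mul_assoc]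

theorem doubleCayleyGraph.translation_injective (a b : Q) (ha : a ≠ 1) (hb : b ≠ 1) :
    Function.Injective (translation a b ha hb) := by
  rw [injective_iff_map_eq_one]
  intro g hg
  have h1 := DFunLike.congr_fun hg (.inl 1)
  have h2 := DFunLike.congr_fun hg (.inr (.inr 1))
  simp [translation] at h1 h2
  exact Prod.ext h1 h2

/-- The two vertices outside the copies of `Q` are the only ones having a twin. -/
theorem doubleCayleyGraph.exists_twin_iff (a b : Q) (ha : a ≠ 1) (hb : b ≠ 1)
    (ha2 : a * a ≠ 1) (hba : b ∉ Subgroup.zpowers a) (hb2 : b * b ≠ a) (v : Q ⊕ Q ⊕ Cyc 2) :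
    (∃ w, w ≠ v ∧ ∀ x, (doubleCayleyGraph a b ha hb).Adj v x ↔
      (doubleCayleyGraph a b ha hb).Adj w x) ↔ ∃ c, v = .inr (.inr c) := by
  constructor
  · rintro ⟨w, hne, h⟩
    have hab1 : a * b ≠ 1 := fun h =>
      hba ⟨-1, by simpa using inv_eq_of_mul_eq_one_right h⟩
    have hnab : b ≠ a := fun h => hba (h ▸ Subgroup.mem_zpowers a)
    have hself := h w
    rw [(doubleCayleyGraph a b ha hb).adj_comm] at hself
    replace hself : ¬ (doubleCayleyGraph a b ha hb).Adj w v := by simpa using hself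
    have hcross (x y : Q) (hxy : ∀ z, y = z ∨ y = z * a ∨ y = z * b) : False := by
      rcases hxy (y * a) with h | h | h
      · simp [ha] at h
      · simp [mul_assoc, ha2] at h
      · simp [mul_assoc, hab1] at h
    rcases v with x | x | x
    · exfalso
      rcases w with y | y | y
      · have h1 := h (.inr (.inl x))
        have h2 := h (.inl (x * a))
        simp [doubleCayleyGraph, doubleCayleyAdj] at h1 h2 hself
        rcases h1 with rfl | rfl | rfl
        · exact hne rfl
        · simp at hself
        · rw [mul_eq_left, mul_assoc, mul_assoc, left_eq_mul, mul_eq_one_iff_eq_inv] at h2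
          rcases h2 with h2 | h2
          · exact hb h2
          · exact hba (h2 ▸ inv_mem (mul_mem (Subgroup.mem_zpowers a) (Subgroup.mem_zpowers a)))
      · simpa [doubleCayleyGraph, doubleCayleyAdj] using h (.inr (.inr 1))
      · simp [doubleCayleyGraph, doubleCayleyAdj] at hself
    · exfalso
      rcases w with y | y | y
      · simpa [doubleCayleyGraph, doubleCayleyAdj] using h (.inr (.inr 1))
      · have h1 := h (.inl x)
        have h2 := h (.inr (.inl (x * b)))
        simp [doubleCayleyGraph, doubleCayleyAdj] at h1 h2 hself
        rcases h1 with rfl | rfl | rfl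
        · exact hne rfl
        · simp [mul_assoc, ha, hb2.symm] at h2
        · simp at hself
      · refine hcross 1 x fun z => ?_
        simpa [doubleCayleyGraph, doubleCayleyAdj] using h (.inl z)
    · exact ⟨x, rfl⟩
  · rintro ⟨c, rfl⟩
    refine ⟨.inr (.inr (c * Multiplicative.ofAdd 1)), by simp, ?_⟩
    rintro (x | x | x) <;> simp [doubleCayleyGraph, doubleCayleyAdj]

theorem doubleCayleyGraph.translation_surjective (a b : Q) (ha : a ≠ 1) (hb : b ≠ 1)
    (ha2 : a * a ≠ 1) (hba : b ∉ Subgroup.zpowers a) (hb2 : b * b ≠ a)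
    (hgen : Subgroup.closure {a, b} = ⊤) :
    Function.Surjective (translation a b ha hb) := by
  intro σ
  have htwin := exists_twin_iff a b ha hb ha2 hba hb2
  have hσ (v w) : (doubleCayleyGraph a b ha hb).Adj (σ v) (σ w) ↔
    (doubleCayleyGraph a b ha hb).Adj v w := σ.map_adj_iff
  have hP (v) : (∃ c, σ v = .inr (.inr c)) ↔ ∃ c, v = .inr (.inr c) := by
    rw [← htwin, ← htwin]
    constructor
    · rintro ⟨w, hw, h⟩
      obtain ⟨w, rfl⟩ := σ.surjective w
      refine ⟨w, fun h => hw (congrArg σ h), fun x => ?_⟩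
      rw [← hσ, h, hσ]
    · rintro ⟨w, hw, h⟩
      refine ⟨σ w, fun h => hw (σ.injective h), fun x => ?_⟩
      obtain ⟨x, rfl⟩ := σ.surjective x
      rw [hσ, h, hσ]
  have h2 (c) : ∃ d, σ (.inr (.inr c)) = .inr (.inr d) := (hP _).2 ⟨c, rfl⟩
  have hL (c v) : (doubleCayleyGraph a b ha hb).Adj (.inr (.inr c)) v ↔ ∃ x, v = .inl x := by
    rcases v with x | x | x <;> simp [doubleCayleyGraph, doubleCayleyAdj]
  have hlay (v) : (∃ y, σ v = .inl y) ↔ ∃ y, v = .inl y := by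
    obtain ⟨d, hd⟩ := h2 1
    rw [← hL d, ← hd, hσ, hL]
  have h0 (x) : ∃ y, σ (.inl x) = .inl y := (hlay _).2 ⟨x, rfl⟩
  have h1 (x) : ∃ y, σ (.inr (.inl x)) = .inr (.inl y) := by
    rcases h : σ (.inr (.inl x)) with y | y | y
    · simpa using (hlay _).1 ⟨y, h⟩
    · exact ⟨y, rfl⟩
    · simpa using (hP _).1 ⟨y, h⟩
  choose p hp using h2
  choose s hs using h0
  choose t ht using h1
  have hs_surj (y) : ∃ x, s x = y := by
    obtain ⟨v, hv⟩ := σ.surjective (.inl y)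
    obtain ⟨x, rfl⟩ := (hlay v).1 ⟨y, hv⟩
    exact ⟨x, by simpa [hs] using hv⟩
  have hss (x y) : (s y = s x * a ∨ s x = s y * a) ↔ (y = x * a ∨ x = y * a) := by
    have := hσ (.inl x) (.inl y)
    rwa [hs, hs] at this
  have hst (x y) : (t y = s x ∨ t y = s x * a ∨ t y = s x * b) ↔
      (y = x ∨ y = x * a ∨ y = x * b) := by
    have := hσ (.inl x) (.inr (.inl y))
    rwa [hs, ht] at this
  have htt (x y) : (t y = t x * b ∨ t x = t y * b) ↔ (y = x * b ∨ x = y * b) := by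
    have := hσ (.inr (.inl x)) (.inr (.inl y))
    rwa [ht, ht] at this
  have htinj (x y) (h : t x = t y) : x = y := by
    have := σ.injective ((ht x).trans ((congrArg _ (congrArg _ h)).trans (ht y).symm))
    simpa using this
  -- the edges from `x` to `x * b` are the only ones between the copies without a common
  -- neighbour in the first copy
  have hab1 : a * b ≠ 1 := fun h =>
    hba ⟨-1, by simpa using inv_eq_of_mul_eq_one_right h⟩
  have hnab : b ≠ a := fun h => hba (h ▸ Subgroup.mem_zpowers a)
  have hnaab : b ≠ a * a := fun h => hba ⟨2, by rw [h]; exact zpow_two a⟩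
  have hno (x x') (hx : x' = x * a ∨ x = x' * a) :
      ¬ (x * b = x' ∨ x * b = x' * a ∨ x * b = x' * b) := by
    rcases hx with rfl | rfl <;> simp [mul_assoc, *]
  have htb (x) : t (x * b) = s x * b := by
    rcases (hst x (x * b)).2 (by simp) with h | h | h
    · obtain ⟨x', hx'⟩ := hs_surj (s x * a⁻¹)
      refine absurd ((hst x' (x * b)).1 ?_) (hno x x' ((hss _ _).1 ?_)) <;> simp [hx', h]
    · obtain ⟨x', hx'⟩ := hs_surj (s x * a)
      refine absurd ((hst x' (x * b)).1 ?_) (hno x x' ((hss _ _).1 ?_)) <;> simp [hx', h]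
    · exact h
  have hts (x) : t x = s x := by
    rcases (hst x x).2 (by simp) with h | h | h
    · exact h
    · rcases (htt x (x * b)).2 (by simp) with h' | h'
      · rw [htb] at h'
        exact (mul_right_cancel h').symm
      · rw [htb, h, mul_assoc] at h'
        exact absurd (mul_left_cancel h') hb2.symm
    · rw [← htb] at h
      exact absurd (htinj _ _ h) (by simp [hb])
  have hsb (x) : s (x * b) = s x * b := by rw [← hts, htb]
  have hsa (x) : s (x * a) = s x * a := by
    rcases (hst x (x * a)).2 (by simp) with h | h | h
    · rw [← hts] at h
      exact absurd (htinj _ _ h) (by simp [ha])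
    · rw [← hts, h]
    · rw [← htb] at h
      exact absurd (htinj _ _ h) (by simp [hnab.symm])
  have hsg (g) : ∀ x, s (x * g) = s x * g := by
    have hg : g ∈ Subgroup.closure {a, b} := by rw [hgen]; trivial
    induction hg using Subgroup.closure_induction with
    | mem g hg => rcases hg with rfl | rfl <;> assumption
    | one => simp
    | mul g h _ _ hg hh => intro x; rw [← mul_assoc, hh, hg, mul_assoc]
    | inv g _ hg => intro x; rw [eq_mul_inv_iff_mul_eq, ← hg, inv_mul_cancel_right]
  have hs1 (x) : s x = s 1 * x := by rw [← hsg, one_mul]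
  have hp1 (c) : p c = p 1 * c := by
    have hinj (c d) (h : p c = p d) : c = d := by
      have := σ.injective ((hp c).trans ((congrArg _ (congrArg _ h)).trans (hp d).symm))
      simpa using this
    have h2 : ∀ c d e : Cyc 2, (d = e → c = 1) → (c = 1 → d = e) → d = e * c := by decide
    exact h2 c (p c) (p 1) (hinj c 1) (by rintro rfl; rfl)
  refine ⟨(s 1, p 1), ?_⟩
  ext (x | x | x)
  · simp [translation, hs, ← hs1]
  · simp [translation, ht, hts, ← hs1]
  · simp [translation, hp, ← hp1]

end UpperBound

section GraphAlpha

/-- Graph isomorphisms induce isomorphisms of automorphism groups. -/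
def SimpleGraph.Iso.autCongr {V W : Type*} {Γ : SimpleGraph V} {Δ : SimpleGraph W} (e : Γ ≃g Δ) :
    (Γ ≃g Γ) ≃* (Δ ≃g Δ) where
  toFun f := (e.symm.trans f).trans e
  invFun f := (e.trans f).trans e.symm
  left_inv f := by ext x; simp
  right_inv f := by ext x; simp
  map_mul' f g := by ext x; simp

theorem card_mem_of_mulEquiv_aut {V G : Type*} [Finite V] [Group G] (Γ : SimpleGraph V)
    (e : (Γ ≃g Γ) ≃* G) :
    Nat.card V ∈ {n : ℕ | ∃ Γ : SimpleGraph (Fin n), Nonempty ((Γ ≃g Γ) ≃* G)} :=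
  ⟨Γ.map (Finite.equivFin V).toEmbedding,
    ⟨(SimpleGraph.Iso.map (Finite.equivFin V) Γ).autCongr.symm.trans e⟩⟩

/-- Lower bound for `graphAlpha` when every subgroup of `G` avoiding the central element `z` is
contained in `{1, t, z * t}`. -/
theorem card_add_two_le_of_mulEquiv_aut {G : Type*} [Group G] [Finite G]
    (A : Subgroup G) (z t : G) (hz : ∀ g, z * g = g * z) (ht : ∀ g, t * g = g * t)
    (hz1 : z ≠ 1) (ht1 : t ≠ 1) (hzt : z ≠ t) (hzz : z * z = 1) (htt : t * t = 1)
    (hzA : z ∈ A) (htA : t ∈ A)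
    (hinv : ∀ x ∉ A, x⁻¹ = z * x) {b : G} (hb : b ∉ A)
    (hsub : ∀ H : Subgroup G, z ∉ H → ∀ h ∈ H, h = 1 ∨ h = t ∨ h = z * t)
    {V : Type*} [Finite V] (Γ : SimpleGraph V) (e : (Γ ≃g Γ) ≃* G) :
    Nat.card G + 2 ≤ Nat.card V := by
  let _ : MulAction G V :=
    { smul g v := e.symm g v
      one_smul v := by
        show e.symm 1 v = v
        rw [map_one]; rfl
      mul_smul g h v := by
        show e.symm (g * h) v = e.symm g (e.symm h v)
        rw [map_mul]; rfl }
  refine Γ.card_add_two_le_of_forall_inv_eq_central_mul (fun g v w => (e.symm g).map_adj_iff)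
    (fun σ => ⟨e σ, fun v => ?_⟩) (fun g hg => ?_) A z t hz ht hz1 ht1 hzt hzz htt hzA htA hinv hb
    hsub
  · show σ v = e.symm (e σ) v
    rw [e.symm_apply_apply]
  · rw [← e.symm.map_eq_one_iff]
    exact RelIso.ext hg

end GraphAlpha

namespace QuaternionGroup

theorem natCast_ne_zero (n : ℕ) [NeZero n] : (n : ZMod (2 * n)) ≠ 0 := by
  rw [Ne, ZMod.natCast_eq_zero_iff]
  intro h
  have := Nat.le_of_dvd (NeZero.pos n) h
  have := NeZero.pos n
  omega

theorem natCast_add_self (n : ℕ) : (n : ZMod (2 * n)) + n = 0 := by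
  have := ZMod.natCast_self (2 * n)
  push_cast at this
  exact (two_mul _).symm.trans this

theorem neg_natCast (n : ℕ) : -(n : ZMod (2 * n)) = n :=
  neg_eq_of_add_eq_zero_left (natCast_add_self n)

theorem eq_one_or_eq_a_of_mul_self_eq_one {n : ℕ} [NeZero n] (q : QuaternionGroup n)
    (hq : q * q = 1) : q = 1 ∨ q = a n := by
  rcases q with i | i
  · rw [a_mul_a, one_def, a.injEq] at hq
    have hi : ((2 * i.val : ℕ) : ZMod (2 * n)) = 0 := by
      push_cast
      rw [ZMod.natCast_zmod_val]
      exact (two_mul i).trans hq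
    rw [ZMod.natCast_eq_zero_iff] at hi
    obtain ⟨c, hc⟩ := Nat.dvd_of_mul_dvd_mul_left two_pos hi
    have hlt := i.val_lt
    have hc2 : c < 2 := by
      by_contra! h
      nlinarith [NeZero.pos n]
    rw [← ZMod.natCast_zmod_val i, hc, one_def]
    interval_cases c <;> simp
  · rw [xa_mul_xa, add_sub_cancel_right, one_def, a.injEq] at hq
    exact absurd hq (natCast_ne_zero n)

theorem a_natCast_mul_comm {n : ℕ} (q : QuaternionGroup n) : a n * q = q * a n := by
  rcases q with i | i
  · rw [a_mul_a, a_mul_a, add_comm]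
  · rw [a_mul_xa, xa_mul_a, sub_eq_add_neg, neg_natCast]

theorem closure_a_xa (n : ℕ) [NeZero n] :
    Subgroup.closure {a 1, (xa 0 : QuaternionGroup n)} = ⊤ := by
  have ha (i) : a i ∈ Subgroup.closure {a 1, (xa 0 : QuaternionGroup n)} := by
    rw [← ZMod.natCast_zmod_val i, ← a_one_pow]
    exact pow_mem (Subgroup.subset_closure (by simp)) _
  rw [eq_top_iff]
  rintro (i | i) -
  · exact ha i
  · have h0 : xa 0 ∈ Subgroup.closure {a 1, (xa 0 : QuaternionGroup n)} :=
      Subgroup.subset_closure (by simp)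
    simpa using mul_mem h0 (ha i)

/-- The cyclic subgroup of index two formed by the elements `a i`. -/
def rotations (n : ℕ) : Subgroup (QuaternionGroup n) where
  carrier := Set.range a
  one_mem' := ⟨0, rfl⟩
  mul_mem' := by
    rintro _ _ ⟨i, rfl⟩ ⟨j, rfl⟩
    exact ⟨i + j, rfl⟩
  inv_mem' := by
    rintro _ ⟨i, rfl⟩
    exact ⟨-i, rfl⟩

theorem a_mem_rotations {n : ℕ} (i : ZMod (2 * n)) : a i ∈ rotations n := ⟨i, rfl⟩

theorem xa_notMem_rotations {n : ℕ} (i : ZMod (2 * n)) : xa i ∉ rotations n := by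
  rintro ⟨j, hj⟩
  cases hj

theorem xa_notMem_zpowers {n : ℕ} (i : ZMod (2 * n)) :
    (xa i : QuaternionGroup n) ∉ Subgroup.zpowers (a 1) := fun h =>
  xa_notMem_rotations i (Subgroup.zpowers_le.mpr (a_mem_rotations 1) h)

/-- For the quaternion `2`-groups, a subgroup of `QuaternionGroup n × Cyc 2` not containing the
central involution of the first factor is contained in `{1, t, z * t}`. -/
theorem eq_of_mem_of_a_notMem {k : ℕ}
    (H : Subgroup (QuaternionGroup (2 ^ k) × Cyc 2))
    (hH : (a (2 ^ k : ℕ), 1) ∉ H) (h : QuaternionGroup (2 ^ k) × Cyc 2) (hh : h ∈ H) :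
    h = 1 ∨ h = (1, Multiplicative.ofAdd 1) ∨
      h = (a (2 ^ k : ℕ), 1) * (1, Multiplicative.ofAdd 1) := by
  have hcyc (c : Cyc 2) : c * c = 1 := by revert c; decide
  have hcyc' (c : Cyc 2) : c = 1 ∨ c = Multiplicative.ofAdd 1 := by revert c; decide
  by_cases h1 : h.1 * h.1 = 1
  · obtain ⟨q, c⟩ := h
    rcases eq_one_or_eq_a_of_mul_self_eq_one q h1 with rfl | rfl <;>
      rcases hcyc' c with rfl | rfl
    · exact .inl rfl
    · exact .inr (.inl rfl)
    · exact absurd hh hH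
    · exact .inr (.inr (by simp))
  · exfalso
    have hpG : IsPGroup 2 (QuaternionGroup (2 ^ k)) := by
      apply IsPGroup.of_card (n := k + 2)
      rw [Nat.card_eq_fintype_card, card]
      ring
    obtain ⟨j, hj⟩ := IsPGroup.iff_orderOf.mp hpG (h.1 * h.1)
    rcases j with _ | j
    · exact h1 (orderOf_eq_one_iff.mp (by simpa using hj))
    have hy : (h.1 * h.1) ^ 2 ^ j ≠ 1 := by
      intro h2
      have h3 := orderOf_dvd_of_pow_eq_one h2
      rw [hj, Nat.pow_dvd_pow_iff_le_right (by norm_num)] at h3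
      omega
    have hyy : (h.1 * h.1) ^ 2 ^ j * (h.1 * h.1) ^ 2 ^ j = 1 := by
      rw [← pow_add, ← two_mul, ← pow_succ', ← hj, pow_orderOf_eq_one]
    have hya := (eq_one_or_eq_a_of_mul_self_eq_one _ hyy).resolve_left hy
    apply hH
    have : (h * h) ^ 2 ^ j = (a (2 ^ k : ℕ), 1) :=
      Prod.ext (by simpa using hya) (by simp [hcyc])
    rw [← this]
    exact pow_mem (mul_mem hh hh) _

theorem inv_eq_of_notMem_rotations {n : ℕ} (q : QuaternionGroup n) (hq : q ∉ rotations n) :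
    q⁻¹ = a n * q := by
  rcases q with i | i
  · exact absurd (a_mem_rotations i) hq
  · rw [inv_eq_iff_mul_eq_one, a_mul_xa, xa_mul_xa, one_def, a.injEq, ← add_sub_assoc,
      sub_right_comm, add_sub_cancel_right, sub_self]

end QuaternionGroup

open QuaternionGroup in
/-- Proposition: for `r ≥ 3`, the group `Q_{2^r} × C₂` of order `2^(r+1)`
satisfies `α(Q_{2^r} × C₂) = 2^(r+1) + 2`. Here
`Q_{2^r} = QuaternionGroup (2 ^ (r - 2))`. -/
theorem alpha_generalizedQuaternion_times_C2 (r : ℕ) (hr : 3 ≤ r) :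
    graphAlpha (QuaternionGroup (2 ^ (r - 2)) × Cyc 2) = 2 ^ (r + 1) + 2 := by
  obtain ⟨k, rfl⟩ : ∃ k, r = k + 3 := ⟨r - 3, by omega⟩
  rw [show k + 3 - 2 = k + 1 by omega]
  have hcQ : Nat.card (QuaternionGroup (2 ^ (k + 1))) = 2 ^ (k + 3) := by
    rw [Nat.card_eq_fintype_card, QuaternionGroup.card]
    ring
  have hcC : Nat.card (Cyc 2) = 2 := by rw [Nat.card_eq_fintype_card]; rfl
  have hcyc (c : Cyc 2) : c * c = 1 := by revert c; decide
  have hinv (c : Cyc 2) : c⁻¹ = c := by revert c; decide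
  have h2 : (1 : ZMod (2 * 2 ^ (k + 1))) + 1 ≠ 0 := by
    intro h
    have h' : ((2 : ℕ) : ZMod (2 * 2 ^ (k + 1))) = 0 := by rw [← h]; norm_num
    rw [ZMod.natCast_eq_zero_iff] at h'
    have := Nat.le_of_dvd two_pos h'
    have := Nat.one_le_two_pow (n := k)
    omega
  have h1 : ((2 ^ (k + 1) : ℕ) : ZMod (2 * 2 ^ (k + 1))) ≠ 1 := by
    intro h
    exact h2 (by rw [← h, natCast_add_self])
  have hmem : 2 ^ (k + 3 + 1) + 2 ∈ {n : ℕ | ∃ Γ : SimpleGraph (Fin n),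
      Nonempty ((Γ ≃g Γ) ≃* (QuaternionGroup (2 ^ (k + 1)) × Cyc 2))} := by
    have ha2 : (a 1 : QuaternionGroup (2 ^ (k + 1))) * a 1 ≠ 1 := by
      rw [a_mul_a, one_def, Ne, a.injEq]
      exact h2
    have ha : (a 1 : QuaternionGroup (2 ^ (k + 1))) ≠ 1 := fun h => ha2 (by rw [h, one_mul])
    have hb : (xa 0 : QuaternionGroup (2 ^ (k + 1))) ≠ 1 := by
      rw [one_def]
      exact fun h => nomatch h
    have hb2 : (xa 0 : QuaternionGroup (2 ^ (k + 1))) * xa 0 ≠ a 1 := by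
      rw [xa_mul_xa, add_sub_cancel_right, Ne, a.injEq]
      exact h1
    have := card_mem_of_mulEquiv_aut (doubleCayleyGraph _ _ ha hb) (MulEquiv.ofBijective _
      ⟨doubleCayleyGraph.translation_injective _ _ ha hb,
        doubleCayleyGraph.translation_surjective _ _ ha hb ha2 (xa_notMem_zpowers 0) hb2
          (closure_a_xa _)⟩).symm
    convert this using 1
    rw [Nat.card_sum, Nat.card_sum, hcQ, hcC]
    ring
  refine le_antisymm (Nat.sInf_le hmem) (le_csInf ⟨_, hmem⟩ ?_)
  rintro n ⟨Γ, ⟨e⟩⟩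
  have hz : (a (2 ^ (k + 1) : ℕ) : QuaternionGroup (2 ^ (k + 1))) ≠ 1 := by
    rw [one_def, Ne, a.injEq]
    exact natCast_ne_zero _
  have hzz : (a (2 ^ (k + 1) : ℕ) : QuaternionGroup (2 ^ (k + 1))) * a (2 ^ (k + 1) : ℕ) = 1 := by
    rw [a_mul_a, natCast_add_self, a_zero]
  have hC : (Multiplicative.ofAdd 1 : Cyc 2) ≠ 1 := by decide
  have hle := card_add_two_le_of_mulEquiv_aut ((rotations (2 ^ (k + 1))).prod ⊤)
    (a (2 ^ (k + 1) : ℕ), 1) (1, Multiplicative.ofAdd 1)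
    (fun g => Prod.ext (a_natCast_mul_comm _) (by simp))
    (fun g => Prod.ext (by simp) (mul_comm _ _))
    (fun h => hz (congrArg Prod.fst h)) (fun h => hC (congrArg Prod.snd h))
    (fun h => hz (congrArg Prod.fst h))
    (Prod.ext hzz (hcyc _))
    (Prod.ext (by simp) (hcyc _))
    ⟨a_mem_rotations _, trivial⟩ ⟨one_mem _, trivial⟩
    (fun x hx => Prod.ext (inv_eq_of_notMem_rotations _ fun h => hx ⟨h, trivial⟩)
      (by simp [hinv]))
    (b := (xa 0, 1)) (fun h => xa_notMem_rotations 0 h.1)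
    (fun H hH => eq_of_mem_of_a_notMem H hH) Γ e
  rw [Nat.card_prod, hcQ, hcC, Nat.card_fin] at hle
  rwa [pow_succ]
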